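/- If a topological space X is θ-weakly homeomorphic to an sw-regular space, then X is sw-regular; if X is θ-weakly homeomorphic to a wθ-regular space, then X is wθ-regular. -/

import Mathlib

open Set Topology TopologicalSpace

universe u v w

/-- A set `U` in a topological space is *θ-open* if each of its points has an open
neighborhood whose closure is contained in `U`. -/
def IsThetaOpen {X : Type*} [TopologicalSpace X] (U : Set X) : Prop :=
  ∀ x ∈ U, ∃ O : Set X, IsOpen O ∧ x ∈ O ∧ closure O ⊆ U

/-- `V` is a θ-open subset of the subspace `A ⊆ X` (with its subspace topology). -/
def IsThetaOpenIn {X : Type*} [TopologicalSpace X] (V A : Set X) : Prop :=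
  V ⊆ A ∧ IsThetaOpen ((Subtype.val ⁻¹' V) : Set A)

/-- `C(f|A)`: the set of points of `A` at which the restriction `f|A : A → Y`
(with `A` carrying the subspace topology) is continuous. -/
def ContPts {X Y : Type*} [TopologicalSpace X] [TopologicalSpace Y] (f : X → Y) (A : Set X) :
    Set X :=
  {x | ∃ hx : x ∈ A, ContinuousAt (A.restrict f) ⟨x, hx⟩}

/-- `f` is scatteredly continuous if for every nonempty `A ⊆ X` the set `C(f|A)` is nonempty. -/
def ScatteredlyContinuous {X Y : Type*} [TopologicalSpace X] [TopologicalSpace Y]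
    (f : X → Y) : Prop :=
  ∀ A : Set X, A.Nonempty → (ContPts f A).Nonempty

/-- `f` is weakly discontinuous if for every nonempty `A ⊆ X` the set `C(f|A)` has
nonempty interior in `A`. -/
def WeaklyDiscontinuous {X Y : Type*} [TopologicalSpace X] [TopologicalSpace Y]
    (f : X → Y) : Prop :=
  ∀ A : Set X, A.Nonempty → (interior ((Subtype.val ⁻¹' ContPts f A) : Set A)).Nonempty

/-- `f` is θ-weakly discontinuous if for every nonempty `A ⊆ X` the set `C(f|A)` contains
a nonempty θ-open subset of the subspace `A`. -/
def ThetaWeaklyDiscontinuous {X Y : Type*} [TopologicalSpace X] [TopologicalSpace Y]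
    (f : X → Y) : Prop :=
  ∀ A : Set X, A.Nonempty → ∃ V : Set X, V.Nonempty ∧ V ⊆ ContPts f A ∧ IsThetaOpenIn V A

/-- `X` is sw-regular if every scatteredly continuous function from any topological space
to `X` is weakly discontinuous. -/
def SwRegular.{t, s} (X : Type s) [TopologicalSpace X] : Prop :=
  ∀ (Z : Type t) (_ : TopologicalSpace Z) (f : Z → X),
    ScatteredlyContinuous f → WeaklyDiscontinuous f

/-- `X` is wθ-regular if every weakly discontinuous function from `X` to any topological
space is θ-weakly discontinuous. -/
def WThetaRegular.{t, s} (X : Type s) [TopologicalSpace X] : Prop :=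
  ∀ (Y : Type t) (_ : TopologicalSpace Y) (f : X → Y),
    WeaklyDiscontinuous f → ThetaWeaklyDiscontinuous f

/-- A bijection (given as an equivalence) is a θ-weak homeomorphism if it and its inverse
are θ-weakly discontinuous. -/
def IsThetaWeakHomeomorph {X Y : Type*} [TopologicalSpace X] [TopologicalSpace Y]
    (e : X ≃ Y) : Prop :=
  ThetaWeaklyDiscontinuous (e : X → Y) ∧ ThetaWeaklyDiscontinuous (e.symm : Y → X)

/-- A bijection (given as an equivalence) is a weak homeomorphism if it and its inverse
are weakly discontinuous. -/
def IsWeakHomeomorph {X Y : Type*} [TopologicalSpace X] [TopologicalSpace Y]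
    (e : X ≃ Y) : Prop :=
  WeaklyDiscontinuous (e : X → Y) ∧ WeaklyDiscontinuous (e.symm : Y → X)

/-- `X` is θ-weakly regular if it is θ-weakly homeomorphic to a regular space. -/
def ThetaWeaklyRegular.{t, s} (X : Type s) [TopologicalSpace X] : Prop :=
  ∃ (Y : Type t) (_ : TopologicalSpace Y), RegularSpace Y ∧
    ∃ e : X ≃ Y, IsThetaWeakHomeomorph e

/-- `X` is weakly regular if it is weakly homeomorphic to a regular space. -/
def WeaklyRegular.{t, s} (X : Type s) [TopologicalSpace X] : Prop :=
  ∃ (Y : Type t) (_ : TopologicalSpace Y), RegularSpace Y ∧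
    ∃ e : X ≃ Y, IsWeakHomeomorph e

section Reformulations

variable {X Y Z : Type*} [TopologicalSpace X] [TopologicalSpace Y] [TopologicalSpace Z]

theorem mem_contPts {f : X → Y} {A : Set X} {x : X} :
    x ∈ ContPts f A ↔ x ∈ A ∧ ContinuousWithinAt f A x := by
  constructor
  · rintro ⟨hx, h⟩
    exact ⟨hx, (continuousWithinAt_iff_continuousAt_domRestrict f hx).2 h⟩
  · rintro ⟨hx, h⟩
    exact ⟨hx, (continuousWithinAt_iff_continuousAt_domRestrict f hx).1 h⟩

theorem isThetaOpenIn_iff {V A : Set X} :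
    IsThetaOpenIn V A ↔
      V ⊆ A ∧ ∀ x ∈ V, ∃ O : Set X, IsOpen O ∧ x ∈ O ∧ A ∩ closure (A ∩ O) ⊆ V := by
  refine and_congr_right fun hVA => ⟨fun h x hx => ?_, fun h x hx => ?_⟩
  · obtain ⟨_, ⟨O, hO, rfl⟩, hxO, hcl⟩ := h ⟨x, hVA hx⟩ hx
    refine ⟨O, hO, hxO, fun y hy => hcl (a := ⟨y, hy.1⟩) (closure_subtype.2 ?_)⟩
    rw [Subtype.image_preimage_coe]
    exact hy.2
  · obtain ⟨O, hO, hxO, hcl⟩ := h x hx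
    refine ⟨Subtype.val ⁻¹' O, hO.preimage continuous_subtype_val, hxO, fun y hy => ?_⟩
    have hy' := closure_subtype.1 hy
    rw [Subtype.image_preimage_coe] at hy'
    exact hcl ⟨y.2, hy'⟩

/-- A θ-open subset of a subspace is relatively open. -/
theorem IsThetaOpenIn.exists_isOpen {V A : Set X} (h : IsThetaOpenIn V A) {x : X} (hx : x ∈ V) :
    ∃ O : Set X, IsOpen O ∧ x ∈ O ∧ A ∩ O ⊆ V := by
  obtain ⟨O, hO, hxO, hcl⟩ := (isThetaOpenIn_iff.1 h).2 x hx
  exact ⟨O, hO, hxO, fun y hy => hcl ⟨hy.1, subset_closure hy⟩⟩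

theorem weaklyDiscontinuous_iff {f : X → Y} :
    WeaklyDiscontinuous f ↔ ∀ A : Set X, A.Nonempty →
      ∃ U : Set X, IsOpen U ∧ (A ∩ U).Nonempty ∧ ContinuousOn f (A ∩ U) := by
  refine forall₂_congr fun A _ => ⟨?_, ?_⟩
  · rintro ⟨x, hx⟩
    obtain ⟨_, hsub, ⟨U, hU, rfl⟩, hxU⟩ := mem_interior.1 hx
    exact ⟨U, hU, ⟨x, x.2, hxU⟩, fun y hy =>
      (mem_contPts.1 (hsub (a := ⟨y, hy.1⟩) hy.2)).2.mono inter_subset_left⟩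
  · rintro ⟨U, hU, ⟨x, hxA, hxU⟩, hf⟩
    refine ⟨⟨x, hxA⟩, mem_interior.2
      ⟨Subtype.val ⁻¹' U, fun y hy => ?_, hU.preimage continuous_subtype_val, hxU⟩⟩
    exact mem_contPts.2 ⟨y.2, (continuousWithinAt_inter (hU.mem_nhds hy)).1 (hf y ⟨y.2, hy⟩)⟩

theorem thetaWeaklyDiscontinuous_iff {f : X → Y} :
    ThetaWeaklyDiscontinuous f ↔ ∀ A : Set X, A.Nonempty →
      ∃ V : Set X, V.Nonempty ∧ IsThetaOpenIn V A ∧ ContinuousOn f V := by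
  refine forall₂_congr fun A _ => exists_congr fun V => and_congr_right fun _ => ⟨?_, ?_⟩
  · exact fun ⟨hV, hth⟩ => ⟨hth, fun x hx => (mem_contPts.1 (hV hx)).2.mono hth.1⟩
  · refine fun ⟨hth, hf⟩ => ⟨fun x hx => mem_contPts.2 ⟨hth.1 hx, ?_⟩, hth⟩
    obtain ⟨O, hO, hxO, hsub⟩ := hth.exists_isOpen hx
    exact (continuousWithinAt_inter (hO.mem_nhds hxO)).1 ((hf x hx).mono hsub)

theorem ThetaWeaklyDiscontinuous.weaklyDiscontinuous {f : X → Y}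
    (hf : ThetaWeaklyDiscontinuous f) : WeaklyDiscontinuous f := by
  refine weaklyDiscontinuous_iff.2 fun A hA => ?_
  obtain ⟨V, ⟨x, hx⟩, hth, hc⟩ := thetaWeaklyDiscontinuous_iff.1 hf A hA
  obtain ⟨O, hO, hxO, hsub⟩ := hth.exists_isOpen hx
  exact ⟨O, hO, ⟨x, hth.1 hx, hxO⟩, hc.mono hsub⟩

theorem WeaklyDiscontinuous.comp {g : Y → Z} {f : X → Y} (hg : WeaklyDiscontinuous g)
    (hf : WeaklyDiscontinuous f) : WeaklyDiscontinuous (g ∘ f) := by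
  rw [weaklyDiscontinuous_iff] at *
  intro A hA
  obtain ⟨U, hU, hne, hfU⟩ := hf A hA
  obtain ⟨O, hO, ⟨_, ⟨x, hx, rfl⟩, hxO⟩, hgO⟩ := hg (f '' (A ∩ U)) (hne.image f)
  obtain ⟨P, hP, hPO⟩ := continuousOn_iff'.1 hfU O hO
  have hmem : ∀ y ∈ A ∩ (U ∩ P), y ∈ A ∩ U ∧ f y ∈ O := fun y hy =>
    ⟨⟨hy.1, hy.2.1⟩, (hPO.symm.subset ⟨hy.2.2, hy.1, hy.2.1⟩).1⟩
  exact ⟨U ∩ P, hU.inter hP, ⟨x, hx.1, hx.2, (hPO.subset ⟨hxO, hx⟩).1⟩,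
    hgO.comp (hfU.mono fun y hy => (hmem y hy).1)
      fun y hy => ⟨mem_image_of_mem f (hmem y hy).1, (hmem y hy).2⟩⟩

theorem IsThetaOpenIn.trans {V W A : Set X} (hV : IsThetaOpenIn V W) (hW : IsThetaOpenIn W A) :
    IsThetaOpenIn V A := by
  rw [isThetaOpenIn_iff] at *
  refine ⟨hV.1.trans hW.1, fun x hx => ?_⟩
  obtain ⟨O, hO, hxO, hOV⟩ := hV.2 x hx
  obtain ⟨P, hP, hxP, hPW⟩ := hW.2 x (hV.1 hx)
  refine ⟨O ∩ P, hO.inter hP, ⟨hxO, hxP⟩, fun y hy => ?_⟩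
  have hsub : A ∩ (O ∩ P) ⊆ W ∩ O := fun z hz =>
    ⟨hPW ⟨hz.1, subset_closure ⟨hz.1, hz.2.2⟩⟩, hz.2.1⟩
  exact hOV ⟨hPW ⟨hy.1, closure_mono (inter_subset_inter_right A inter_subset_right) hy.2⟩,
    closure_mono hsub hy.2⟩

theorem IsThetaOpenIn.preimage {f : X → Y} {A : Set X} {B V : Set Y} (hV : IsThetaOpenIn V B)
    (hf : ContinuousOn f A) (hAB : MapsTo f A B) : IsThetaOpenIn (A ∩ f ⁻¹' V) A := by
  rw [isThetaOpenIn_iff] at *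
  refine ⟨inter_subset_left, fun x hx => ?_⟩
  obtain ⟨O, hO, hxO, hOV⟩ := hV.2 (f x) hx.2
  obtain ⟨P, hP, hPO⟩ := continuousOn_iff'.1 hf O hO
  refine ⟨P, hP, (hPO.subset ⟨hxO, hx.1⟩).1, fun y hy => ⟨hy.1, hOV ⟨hAB hy.1, ?_⟩⟩⟩
  refine ((hf y hy.1).mono inter_subset_left).mem_closure hy.2 fun z hz => ?_
  exact ⟨hAB hz.1, (hPO.symm.subset ⟨hz.2, hz.1⟩).1⟩

theorem ThetaWeaklyDiscontinuous.comp {g : Y → Z} {f : X → Y} (hg : ThetaWeaklyDiscontinuous g)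
    (hf : ThetaWeaklyDiscontinuous f) : ThetaWeaklyDiscontinuous (g ∘ f) := by
  rw [thetaWeaklyDiscontinuous_iff] at *
  intro A hA
  obtain ⟨V, hne, hVA, hfV⟩ := hf A hA
  obtain ⟨W, ⟨y, hy⟩, hW, hgW⟩ := hg (f '' V) (hne.image f)
  obtain ⟨x, hx, rfl⟩ := hW.1 hy
  exact ⟨V ∩ f ⁻¹' W, ⟨x, hx, hy⟩, (hW.preimage hfV (mapsTo_image f V)).trans hVA,
    hgW.comp (hfV.mono inter_subset_left) fun z hz => hz.2⟩

end Reformulations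

/-- Exhausting a type by transfinitely removing from what is left a nonempty piece selected by
`V`: the rank of a point is the stage at which it is removed. -/
theorem exists_rank_of_selection {X : Type u} (V : Set X → Set X) (hsub : ∀ S, V S ⊆ S)
    (hne : ∀ S : Set X, S.Nonempty → (V S).Nonempty) :
    ∃ r : X → Ordinal.{u}, ∀ α, r ⁻¹' {α} = V {x | α ≤ r x} := by
  obtain ⟨W, hW⟩ : ∃ W : Ordinal.{u} → Set X, ∀ α, W α = V {x | ∀ β < α, x ∉ W β} :=
    ⟨Ordinal.lt_wf.fix fun α W => V {x | ∀ β, ∀ h : β < α, x ∉ W β h},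
      fun α => WellFounded.fix_eq _ _ α⟩
  have hlt : ∀ {α β x}, β < α → x ∈ W α → x ∉ W β := fun {α β x} hβ hx => by
    rw [hW α] at hx
    exact hsub _ hx β hβ
  have huniq : ∀ {α β x}, x ∈ W α → x ∈ W β → α = β := fun {α β x} hα hβ => by
    rcases lt_trichotomy α β with h | h | h
    · exact absurd hα (hlt h hβ)
    · exact h
    · exact absurd hβ (hlt h hα)
  have hex : ∀ x, ∃ α, x ∈ W α := by
    by_contra! ⟨x, hx⟩
    have hWne : ∀ α, (W α).Nonempty := fun α => by
      rw [hW α]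
      exact hne _ ⟨x, fun β _ => hx β⟩
    choose w hw using hWne
    exact not_injective_of_ordinal w fun α β h => huniq (hw α) (h ▸ hw β)
  choose r hr using hex
  refine ⟨r, fun α => ?_⟩
  have hset : {x | α ≤ r x} = {x | ∀ β < α, x ∉ W β} := by
    ext x
    refine ⟨fun h β hβ hx => ?_, fun h => not_lt.1 fun hlt => h _ hlt (hr x)⟩
    exact (hβ.trans_le h).ne (huniq hx (hr x))
  rw [hset, ← hW]
  ext x
  exact ⟨fun h => h ▸ hr x, fun h => huniq (hr x) h⟩

/-- A θ-weakly discontinuous map is continuous on the pieces of a transfinite partition, each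
piece being θ-open in the complement of the preceding ones. -/
theorem ThetaWeaklyDiscontinuous.exists_rank {X : Type u} {Y : Type*} [TopologicalSpace X]
    [TopologicalSpace Y] {f : X → Y} (hf : ThetaWeaklyDiscontinuous f) :
    ∃ r : X → Ordinal.{u}, ∀ α,
      IsThetaOpenIn (r ⁻¹' {α}) {x | α ≤ r x} ∧ ContinuousOn f (r ⁻¹' {α}) := by
  have hV : ∀ S : Set X, ∃ V : Set X,
      (S.Nonempty → V.Nonempty) ∧ IsThetaOpenIn V S ∧ ContinuousOn f V := fun S => by
    rcases S.eq_empty_or_nonempty with rfl | hS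
    · exact ⟨∅, id, ⟨Subset.rfl, fun x => x.2.elim⟩, continuousOn_empty f⟩
    · obtain ⟨V, hne, hV⟩ := thetaWeaklyDiscontinuous_iff.1 hf S hS
      exact ⟨V, fun _ => hne, hV⟩
  choose V hne hth hc using hV
  obtain ⟨r, hr⟩ := exists_rank_of_selection V (fun S => (hth S).1) hne
  exact ⟨r, fun α => by rw [hr α]; exact ⟨hth _, hc _⟩⟩

theorem ContinuousWithinAt.exists_isOpen_mapsTo {Z X : Type*} [TopologicalSpace Z]
    [TopologicalSpace X] {f : Z → X} {A : Set Z} {z : Z} (h : ContinuousWithinAt f A z)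
    {O : Set X} (hO : IsOpen O) (hz : f z ∈ O) :
    ∃ U : Set Z, IsOpen U ∧ z ∈ U ∧ MapsTo f (A ∩ U) O := by
  obtain ⟨U, hU, hzU, hsub⟩ := mem_nhdsWithin.1 (h (hO.mem_nhds hz))
  exact ⟨U, hU, hzU, fun y hy => hsub ⟨hy.2, hy.1⟩⟩

/-- A scatteredly continuous map sends some nonempty relatively open subset of any given nonempty
set into a single piece of a well-ordered partition, provided that each piece is θ-open in the
complement of the preceding ones. -/
theorem ScatteredlyContinuous.exists_isOpen_rank_eq {Z X ι : Type*} [TopologicalSpace Z]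
    [TopologicalSpace X] [LinearOrder ι] [WellFoundedLT ι] {f : Z → X}
    (hf : ScatteredlyContinuous f) {r : X → ι}
    (hr : ∀ α, IsThetaOpenIn (r ⁻¹' {α}) {x | α ≤ r x}) {A : Set Z} (hA : A.Nonempty) :
    ∃ U : Set Z, IsOpen U ∧ (A ∩ U).Nonempty ∧ ∃ α, ∀ z ∈ A ∩ U, r (f z) = α := by
  have hpt : ∀ B : Set Z, B.Nonempty → ∃ z ∈ B, ContinuousWithinAt f B z := fun B hB =>
    let ⟨z, hz⟩ := hf B hB
    ⟨z, mem_contPts.1 hz⟩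
  -- The points of local minimality of the rank are dense in `A`.
  let M : Set Z := {m ∈ A | ∃ U : Set Z, IsOpen U ∧ m ∈ U ∧ ∀ z ∈ A ∩ U, r (f m) ≤ r (f z)}
  have hM : ∀ U : Set Z, IsOpen U → (A ∩ U).Nonempty → ∃ m ∈ M, m ∈ U := fun U hU hne => by
    obtain ⟨m, hm, hmin⟩ := (InvImage.wf (r ∘ f) wellFounded_lt).has_min (A ∩ U) hne
    exact ⟨m, ⟨hm.1, U, hU, hm.2, fun z hz => not_lt.1 (hmin z hz)⟩, hm.2⟩
  have hMne : M.Nonempty :=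
    let ⟨m, hm, _⟩ := hM univ isOpen_univ (by simpa using hA)
    ⟨m, hm⟩
  -- Near a continuity point of `f` on `M`, the rank is constant on `M` and minimal there.
  obtain ⟨m₀, hm₀, hcm⟩ := hpt M hMne
  obtain ⟨U₀, hU₀, hmU₀, hmin⟩ := hm₀.2
  obtain ⟨O₀, hO₀, hmO₀, hOr⟩ := (hr (r (f m₀))).exists_isOpen (x := f m₀) rfl
  obtain ⟨U₁, hU₁, hmU₁, hmaps⟩ := hcm.exists_isOpen_mapsTo hO₀ hmO₀
  generalize hα : r (f m₀) = α at *
  have hMα : ∀ m ∈ M, m ∈ U₀ → m ∈ U₁ → r (f m) = α := fun m hm h0 h1 =>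
    hOr ⟨hmin m ⟨hm.1, h0⟩, hmaps ⟨hm, h1⟩⟩
  let B : Set Z := {z ∈ A ∩ (U₀ ∩ U₁) | r (f z) = α}
  obtain ⟨b, hb, hcb⟩ := hpt B ⟨m₀, ⟨hm₀.1, hmU₀, hmU₁⟩, hα⟩
  obtain ⟨O, hO, hbO, hcl⟩ := (isThetaOpenIn_iff.1 (hr α)).2 (f b) hb.2
  obtain ⟨U₂, hU₂, hbU₂, hBO⟩ := hcb.exists_isOpen_mapsTo hO hbO
  have hU : IsOpen (U₀ ∩ U₁ ∩ U₂) := (hU₀.inter hU₁).inter hU₂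
  obtain ⟨c, hc, hcc⟩ := hpt (A ∩ (U₀ ∩ U₁ ∩ U₂)) ⟨b, hb.1.1, hb.1.2, hbU₂⟩
  by_cases hfc : f c ∈ closure ({x | α ≤ r x} ∩ O)
  · obtain ⟨P, hP, hcP, hPr⟩ := (hr α).exists_isOpen (hcl ⟨hmin c ⟨hc.1, hc.2.1.1⟩, hfc⟩)
    obtain ⟨U₃, hU₃, hcU₃, hmaps₃⟩ := hcc.exists_isOpen_mapsTo hP hcP
    exact ⟨U₀ ∩ U₁ ∩ U₂ ∩ U₃, hU.inter hU₃, ⟨c, hc.1, hc.2, hcU₃⟩, α, fun z hz =>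
      hPr ⟨hmin z ⟨hz.1, hz.2.1.1.1⟩, hmaps₃ ⟨⟨hz.1, hz.2.1⟩, hz.2.2⟩⟩⟩
  · obtain ⟨U₃, hU₃, hcU₃, hmaps₃⟩ := hcc.exists_isOpen_mapsTo isClosed_closure.isOpen_compl hfc
    obtain ⟨m, hm, hmU⟩ := hM _ (hU.inter hU₃) ⟨c, hc.1, hc.2, hcU₃⟩
    have hmα := hMα m hm hmU.1.1.1 hmU.1.1.2
    have hmO : f m ∈ {x | α ≤ r x} ∩ O := ⟨hmα.ge, hBO ⟨⟨⟨hm.1, hmU.1.1⟩, hmα⟩, hmU.1.2⟩⟩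
    exact absurd (subset_closure hmO) (hmaps₃ ⟨⟨hm.1, hmU.1⟩, hmU.2⟩)

theorem ScatteredlyContinuous.comp_restrict_of_continuousOn {Z X Y : Type*} [TopologicalSpace Z]
    [TopologicalSpace X] [TopologicalSpace Y] {f : Z → X} (hf : ScatteredlyContinuous f)
    {g : X → Y} {S : Set Z} {V : Set X} (hg : ContinuousOn g V) (hS : MapsTo f S V) :
    ScatteredlyContinuous (g ∘ S.domRestrict f) := by
  intro T hT
  obtain ⟨_, hz⟩ := hf (Subtype.val '' T) (hT.image _)
  obtain ⟨⟨z, hzT, rfl⟩, hc⟩ := mem_contPts.1 hz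
  have hfz : ContinuousWithinAt (S.domRestrict f) T z :=
    hc.comp continuous_subtype_val.continuousWithinAt (mapsTo_image _ T)
  have hgz : ContinuousWithinAt g V (S.domRestrict f z) := hg _ (hS z.2)
  exact ⟨z, mem_contPts.2 ⟨hzT, hgz.comp hfz fun y _ => hS y.2⟩⟩

theorem SwRegular.of_thetaWeakHomeomorph {X : Type u} {Y : Type v} [TopologicalSpace X]
    [TopologicalSpace Y] {e : X ≃ Y} (he : IsThetaWeakHomeomorph e) (hY : SwRegular.{w, v} Y) :
    SwRegular.{w, u} X := by
  intro Z _ f hf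
  refine weaklyDiscontinuous_iff.2 fun A hA => ?_
  obtain ⟨r, hr⟩ := he.1.exists_rank
  obtain ⟨U, hU, hne, α, hα⟩ := hf.exists_isOpen_rank_eq (fun α => (hr α).1) hA
  have hw : WeaklyDiscontinuous ((A ∩ U).domRestrict f) := by
    have h := he.2.weaklyDiscontinuous.comp
      (hY _ _ _ (hf.comp_restrict_of_continuousOn (hr α).2 hα))
    rwa [← Function.comp_assoc, e.symm_comp_self, Function.id_comp] at h
  obtain ⟨_, ⟨P, hP, rfl⟩, ⟨z, -, hz⟩, hc⟩ :=
    weaklyDiscontinuous_iff.1 hw univ (have := hne.to_subtype; univ_nonempty)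
  refine ⟨U ∩ P, hU.inter hP, ⟨z, z.2.1, z.2.2, hz⟩, ?_⟩
  rw [← inter_assoc, ← Subtype.image_preimage_coe]
  rw [univ_inter] at hc
  exact IsInducing.subtypeVal.continuousOn_image_iff.2 hc

theorem WThetaRegular.of_thetaWeakHomeomorph {X : Type u} {Y : Type v} [TopologicalSpace X]
    [TopologicalSpace Y] {e : X ≃ Y} (he : IsThetaWeakHomeomorph e)
    (hY : WThetaRegular.{w, v} Y) : WThetaRegular.{w, u} X := by
  intro W _ f hf
  have h := (hY W _ _ (hf.comp he.2.weaklyDiscontinuous)).comp he.1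
  rwa [Function.comp_assoc, e.symm_comp_self, Function.comp_id] at h

theorem swRegular_and_wThetaRegular_of_thetaWeakHomeomorph {X : Type u} {Y : Type v}
    [TopologicalSpace X] [TopologicalSpace Y] (e : X ≃ Y) (he : IsThetaWeakHomeomorph e) :
    (SwRegular.{w, v} Y → SwRegular.{w, u} X) ∧
      (WThetaRegular.{w, v} Y → WThetaRegular.{w, u} X) := by
  exact ⟨SwRegular.of_thetaWeakHomeomorph he, WThetaRegular.of_thetaWeakHomeomorph he⟩
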